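/- (Lemma 9, part I: products of the Hermitian terms.) Let n ≥ 2, λ ∈ ℝ, and set s_{j,n} := e^{iλ} s_{j,n}^− + e^{−iλ} s_{j,n}^+. Then for n ≥ j > j' ≥ 2, s_{j,n} s_{j',n} = 0; and for every 2 ≤ j ≤ n, s_{j,n} s_{1,n} = e^{2iλ} s_{j−1,n−1}^− ⊗ σ11 + e^{−2iλ} s_{j−1,n−1}^+ ⊗ σ00 and s_{1,n} s_{j,n} = e^{2iλ} s_{j−1,n−1}^− ⊗ σ00 + e^{−2iλ} s_{j−1,n−1}^+ ⊗ σ11. -/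

import Mathlib

/-!
STATEMENT 11 (Lemma 9, part I: products of the Hermitian terms). Let n ≥ 2, λ ∈ ℝ,
s_{j,n} := e^{iλ} s_{j,n}⁻ + e^{−iλ} s_{j,n}⁺.  Then for n ≥ j > j' ≥ 2,
s_{j,n} s_{j',n} = 0; and for 2 ≤ j ≤ n,
s_{j,n} s_{1,n} = e^{2iλ} s_{j−1,n−1}⁻ ⊗ σ11 + e^{−2iλ} s_{j−1,n−1}⁺ ⊗ σ00 and
s_{1,n} s_{j,n} = e^{2iλ} s_{j−1,n−1}⁻ ⊗ σ00 + e^{−2iλ} s_{j−1,n−1}⁺ ⊗ σ11.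

Matrices on m qubits are indexed by bit strings `Fin m → Fin 2` (index 0 = leftmost Kronecker
factor); the entry of `A ⊗ B` (B a single-qubit matrix) at `(a, b)` is
`A (init a) (init b) * B (a (n−1)) (b (n−1))` where `init` drops the last bit.
-/

open Matrix

noncomputable section

def sig01 : Matrix (Fin 2) (Fin 2) ℂ := !![0, 1; 0, 0]
def sig10 : Matrix (Fin 2) (Fin 2) ℂ := !![0, 0; 1, 0]
def sig00 : Matrix (Fin 2) (Fin 2) ℂ := !![1, 0; 0, 0]
def sig11 : Matrix (Fin 2) (Fin 2) ℂ := !![0, 0; 0, 1]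

def tens {n : ℕ} (M : Fin n → Matrix (Fin 2) (Fin 2) ℂ) :
    Matrix (Fin n → Fin 2) (Fin n → Fin 2) ℂ :=
  Matrix.of fun a b => ∏ k, M k (a k) (b k)

def sMinus (n j : ℕ) : Matrix (Fin n → Fin 2) (Fin n → Fin 2) ℂ :=
  tens fun k => if (k : ℕ) < n - j then 1 else if (k : ℕ) = n - j then sig01 else sig10

def sPlus (n j : ℕ) : Matrix (Fin n → Fin 2) (Fin n → Fin 2) ℂ :=
  tens fun k => if (k : ℕ) < n - j then 1 else if (k : ℕ) = n - j then sig10 else sig01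

/-- `s_{j,n} = e^{iλ} s_{j,n}⁻ + e^{−iλ} s_{j,n}⁺`. -/
def hTerm (n j : ℕ) (lam : ℝ) : Matrix (Fin n → Fin 2) (Fin n → Fin 2) ℂ :=
  Complex.exp (Complex.I * lam) • sMinus n j + Complex.exp (-(Complex.I * lam)) • sPlus n j

/-- The first `n − 1` bits of an `n`-bit string. -/
def init {n : ℕ} (a : Fin n → Fin 2) : Fin (n - 1) → Fin 2 :=
  fun k => a (Fin.castLE (Nat.sub_le n 1) k)

theorem tens_mul {n : ℕ} (M N : Fin n → Matrix (Fin 2) (Fin 2) ℂ) :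
    tens M * tens N = tens fun k => M k * N k := by
  ext a b
  simp only [tens, Matrix.mul_apply, Matrix.of_apply, ← Finset.prod_mul_distrib]
  rw [Finset.prod_univ_sum, Fintype.piFinset_univ]

theorem tens_eq_zero {n : ℕ} {M : Fin n → Matrix (Fin 2) (Fin 2) ℂ} (k : Fin n) (hk : M k = 0) :
    tens M = 0 := by
  ext a b
  exact Finset.prod_eq_zero (Finset.mem_univ k) (by simp [hk])

theorem tens_succ_apply {m : ℕ} (M : Fin (m + 1) → Matrix (Fin 2) (Fin 2) ℂ)
    (a b : Fin (m + 1) → Fin 2) :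
    tens M a b = tens (fun k : Fin m => M k.castSucc) (init a) (init b)
      * M (Fin.last m) (a (Fin.last m)) (b (Fin.last m)) :=
  Fin.prod_univ_castSucc _

/-- The Kronecker product `I^{⊗(n−j)} ⊗ A ⊗ B^{⊗(j−1)}`. -/
def kronTerm (A B : Matrix (Fin 2) (Fin 2) ℂ) (n j : ℕ) :
    Matrix (Fin n → Fin 2) (Fin n → Fin 2) ℂ :=
  tens fun k => if (k : ℕ) < n - j then 1 else if (k : ℕ) = n - j then A else B

theorem sMinus_eq_kronTerm : sMinus = kronTerm sig01 sig10 := rfl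

theorem sPlus_eq_kronTerm : sPlus = kronTerm sig10 sig01 := rfl

theorem kronTerm_mul_eq_zero {A B C D : Matrix (Fin 2) (Fin 2) ℂ} {n j j' : ℕ}
    (hj' : 2 ≤ j') (hlt : j' < j) (hj : j ≤ n) (h : B * C = 0 ∨ B * D = 0) :
    kronTerm A B n j * kronTerm C D n j' = 0 := by
  rw [kronTerm, kronTerm, tens_mul]
  rcases h with h | h
  · refine tens_eq_zero ⟨n - j', by omega⟩ ?_
    simp only [lt_irrefl, if_true, if_false]
    rwa [if_neg (by omega), if_neg (by omega)]
  · refine tens_eq_zero ⟨n - 1, by omega⟩ ?_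
    dsimp only
    rwa [if_neg (by omega), if_neg (by omega), if_neg (by omega), if_neg (by omega)]

theorem kronTerm_mul_kronTerm_one_apply {A B C D : Matrix (Fin 2) (Fin 2) ℂ} {m i : ℕ}
    (hi : 1 ≤ i) (him : i ≤ m) (a b : Fin (m + 1) → Fin 2) :
    (kronTerm A B (m + 1) (i + 1) * kronTerm C D (m + 1) 1) a b =
      kronTerm A B m i (init a) (init b) * (B * C) (a (Fin.last m)) (b (Fin.last m)) := by
  rw [kronTerm, kronTerm, tens_mul, tens_succ_apply, kronTerm]
  congr 2
  · funext k
    simp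
  · rw [if_neg (by simp), if_neg (by simp; omega), if_neg (by simp), if_pos (by simp)]

theorem kronTerm_one_mul_kronTerm_apply {A B C D : Matrix (Fin 2) (Fin 2) ℂ} {m i : ℕ}
    (hi : 1 ≤ i) (him : i ≤ m) (a b : Fin (m + 1) → Fin 2) :
    (kronTerm C D (m + 1) 1 * kronTerm A B (m + 1) (i + 1)) a b =
      kronTerm A B m i (init a) (init b) * (C * B) (a (Fin.last m)) (b (Fin.last m)) := by
  rw [kronTerm, kronTerm, tens_mul, tens_succ_apply, kronTerm]
  congr 2
  · funext k
    simp
  · rw [if_neg (by simp), if_pos (by simp), if_neg (by simp), if_neg (by simp; omega)]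

theorem sig01_mul_sig01 : sig01 * sig01 = 0 := by
  ext i j
  fin_cases i <;> fin_cases j <;> simp [sig01]

theorem sig10_mul_sig10 : sig10 * sig10 = 0 := by
  ext i j
  fin_cases i <;> fin_cases j <;> simp [sig10]

theorem sig01_mul_sig10 : sig01 * sig10 = sig00 := by
  ext i j
  fin_cases i <;> fin_cases j <;> simp [sig01, sig10, sig00]

theorem sig10_mul_sig01 : sig10 * sig01 = sig11 := by
  ext i j
  fin_cases i <;> fin_cases j <;> simp [sig01, sig10, sig11]

theorem hTerm_mul_hTerm (n j j' : ℕ) (lam : ℝ) :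
    hTerm n j lam * hTerm n j' lam =
      Complex.exp (2 * Complex.I * lam) • (sMinus n j * sMinus n j')
        + sMinus n j * sPlus n j' + sPlus n j * sMinus n j'
        + Complex.exp (-(2 * Complex.I * lam)) • (sPlus n j * sPlus n j') := by
  have hpos : Complex.exp (2 * Complex.I * lam)
      = Complex.exp (Complex.I * lam) * Complex.exp (Complex.I * lam) := by
    rw [← Complex.exp_add]; ring_nf
  have hneg : Complex.exp (-(2 * Complex.I * lam))
      = Complex.exp (-(Complex.I * lam)) * Complex.exp (-(Complex.I * lam)) := by
    rw [← Complex.exp_add]; ring_nf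
  have hone : Complex.exp (Complex.I * lam) * Complex.exp (-(Complex.I * lam)) = 1 := by
    rw [← Complex.exp_add, add_neg_cancel, Complex.exp_zero]
  simp only [hTerm, add_mul, mul_add, smul_mul_smul_comm, hpos, hneg, hone,
    mul_comm (Complex.exp (-(Complex.I * lam))) (Complex.exp (Complex.I * lam)), one_smul]
  abel

theorem hermitian_term_products (n : ℕ) (hn : 2 ≤ n) (lam : ℝ) :
    (∀ j j' : ℕ, 2 ≤ j' → j' < j → j ≤ n → hTerm n j lam * hTerm n j' lam = 0) ∧
    (∀ j : ℕ, 2 ≤ j → j ≤ n →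
      (∀ a b : Fin n → Fin 2,
        (hTerm n j lam * hTerm n 1 lam) a b
          = Complex.exp (2 * Complex.I * lam) * sMinus (n - 1) (j - 1) (init a) (init b)
              * sig11 (a ⟨n - 1, by omega⟩) (b ⟨n - 1, by omega⟩)
            + Complex.exp (-(2 * Complex.I * lam)) * sPlus (n - 1) (j - 1) (init a) (init b)
              * sig00 (a ⟨n - 1, by omega⟩) (b ⟨n - 1, by omega⟩)) ∧
      (∀ a b : Fin n → Fin 2,
        (hTerm n 1 lam * hTerm n j lam) a b
          = Complex.exp (2 * Complex.I * lam) * sMinus (n - 1) (j - 1) (init a) (init b)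
              * sig00 (a ⟨n - 1, by omega⟩) (b ⟨n - 1, by omega⟩)
            + Complex.exp (-(2 * Complex.I * lam)) * sPlus (n - 1) (j - 1) (init a) (init b)
              * sig11 (a ⟨n - 1, by omega⟩) (b ⟨n - 1, by omega⟩))) := by
  constructor
  · intro j j' hj' hlt hj
    rw [hTerm_mul_hTerm, sMinus_eq_kronTerm, sPlus_eq_kronTerm,
      kronTerm_mul_eq_zero hj' hlt hj (.inr sig10_mul_sig10),
      kronTerm_mul_eq_zero hj' hlt hj (.inl sig10_mul_sig10),
      kronTerm_mul_eq_zero hj' hlt hj (.inl sig01_mul_sig01),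
      kronTerm_mul_eq_zero hj' hlt hj (.inr sig01_mul_sig01)]
    simp
  · intro j hj hjn
    obtain ⟨m, rfl⟩ : ∃ m, n = m + 1 := ⟨n - 1, by omega⟩
    obtain ⟨i, rfl⟩ : ∃ i, j = i + 1 := ⟨j - 1, by omega⟩
    have hi : 1 ≤ i := by omega
    have him : i ≤ m := by omega
    constructor <;> intro a b <;>
      simp only [hTerm_mul_hTerm, sMinus_eq_kronTerm, sPlus_eq_kronTerm, Matrix.add_apply,
        Matrix.smul_apply, smul_eq_mul, kronTerm_mul_kronTerm_one_apply hi him,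
        kronTerm_one_mul_kronTerm_apply hi him, sig01_mul_sig01, sig10_mul_sig10,
        sig01_mul_sig10, sig10_mul_sig01, Matrix.zero_apply, mul_zero, add_zero, mul_assoc] <;>
      rfl
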